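/- For all a, m ≥ 2 and all n ≥ 0, the subword patterns 1^a 23⋯m and 12⋯(m−1)m^a are equidistributed on non-crossing partitions of [n]: for every k, the number of π ∈ NC_n with exactly k occurrences of 1^a 23⋯m equals the number with exactly k occurrences of 12⋯(m−1)m^a. -/

import Mathlib

/-- `l` is a restricted growth sequence (canonical sequential form of a set
partition): it starts with 1, all letters are ≥ 1, and each letter is at most
one more than the maximum of the preceding prefix. -/
def IsRGS (l : List ℕ) : Prop :=
  l.getD 0 1 = 1 ∧ (∀ x ∈ l, 1 ≤ x) ∧
  ∀ i, i + 1 < l.length → l.getD (i + 1) 0 ≤ (l.take (i + 1)).foldr max 0 + 1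

/-- `l` contains a (classical) occurrence of 1-2-1-2: a subsequence a,b,a,b with a < b. -/
def Crossing (l : List ℕ) : Prop :=
  ∃ i j k m : ℕ, i < j ∧ j < k ∧ k < m ∧ m < l.length ∧
    l.getD i 0 = l.getD k 0 ∧ l.getD j 0 = l.getD m 0 ∧ l.getD i 0 < l.getD j 0

/-- `l` is the canonical sequential form of a non-crossing partition of [n]. -/
def NCseq (n : ℕ) (l : List ℕ) : Prop := l.length = n ∧ IsRGS l ∧ ¬ Crossing l

/-- Two lists of the same length are order-isomorphic. -/
def OrdIso (s t : List ℕ) : Prop :=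
  s.length = t.length ∧ ∀ j k, j < s.length → k < s.length →
    (s.getD j 0 < s.getD k 0 ↔ t.getD j 0 < t.getD k 0)

/-- The subword pattern `τ` occurs in `l` starting at position `i`. -/
def occAt (τ l : List ℕ) (i : ℕ) : Prop := OrdIso τ ((l.drop i).take τ.length)

/-- The number of occurrences of the subword pattern `τ` in `l`. -/
noncomputable def occCount (τ l : List ℕ) : ℕ := Nat.card {i : ℕ // occAt τ l i}

/-- The total number of occurrences of the subword pattern `τ` over all
members of NC_n, counted with multiplicity (as marked occurrences). -/
noncomputable def totalOcc (n : ℕ) (τ : List ℕ) : ℕ :=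
  Nat.card {p : List ℕ × ℕ // NCseq n p.1 ∧ occAt τ p.1 p.2}

/-! ### Counting factors of a list -/

/-- The number of occurrences of a nonempty list `u` as a contiguous factor of a list. -/
def factorCount (u : List ℤ) : List ℤ → ℕ
  | [] => 0
  | x :: l => (if u <+: x :: l then 1 else 0) + factorCount u l

theorem factorCount_concat {u : List ℤ} (hu : u ≠ []) (l : List ℤ) (x : ℤ) :
    factorCount u (l ++ [x]) = factorCount u l + if u <:+ l ++ [x] then 1 else 0 := by
  induction l with
  | nil =>
    have h : u <+: [x] ↔ u <:+ [x] := by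
      constructor
      · intro h
        have := h.eq_of_length_le (by
          have := List.length_pos_iff.2 hu
          simp; omega)
        simp [this]
      · intro h
        have := h.eq_of_length_le (by
          have := List.length_pos_iff.2 hu
          simp; omega)
        simp [this]
    simp [factorCount, h]
  | cons y l ih =>
    simp only [List.cons_append, factorCount, ih]
    have h1 : u <+: y :: (l ++ [x]) ↔ u = y :: (l ++ [x]) ∨ u <+: y :: l :=
      List.prefix_concat_iff (l₂ := y :: l)
    have h2 : u <:+ y :: (l ++ [x]) ↔ u = y :: (l ++ [x]) ∨ u <:+ l ++ [x] :=
      List.suffix_cons_iff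
    by_cases h : u = y :: (l ++ [x])
    · have h3 : ¬ u <+: y :: l := fun h' => by
        have := h'.length_le
        simp [h] at this
      have h4 : ¬ u <:+ l ++ [x] := fun h' => by
        have := h'.length_le
        simp [h] at this
      rw [if_pos (h1.2 (Or.inl h)), if_pos (h2.2 (Or.inl h)), if_neg h3, if_neg h4]
      omega
    · simp only [h1, h2, h, false_or]
      omega

theorem factorCount_reverse {u : List ℤ} (hu : u ≠ []) (l : List ℤ) :
    factorCount u l.reverse = factorCount u.reverse l := by
  induction l with
  | nil => rfl
  | cons x l ih =>
    rw [List.reverse_cons, factorCount_concat hu, ih, factorCount, add_comm]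
    congr 2
    rw [← List.reverse_cons, ← List.reverse_prefix, List.reverse_reverse]

theorem prefix_append_cons_iff {u : List ℤ} {e : ℤ} (he : e ∉ u) (s d : List ℤ) :
    u <+: s ++ e :: d ↔ u <+: s := by
  refine ⟨fun h => ?_, fun h => h.trans (List.prefix_append _ _)⟩
  rcases le_or_gt u.length s.length with hl | hl
  · exact List.prefix_of_prefix_length_le h (List.prefix_append _ _) hl
  · have h' : s ++ [e] <+: u :=
      List.prefix_of_prefix_length_le ⟨d, by simp⟩ h (by simpa using hl)
    exact absurd (h'.subset (by simp)) he

theorem factorCount_append_cons {u : List ℤ} (hu : u ≠ []) {e : ℤ} (he : e ∉ u)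
    (s d : List ℤ) : factorCount u (s ++ e :: d) = factorCount u s + factorCount u d := by
  induction s with
  | nil =>
    have h : ¬ u <+: e :: d := by
      have := prefix_append_cons_iff he [] d
      simpa [hu] using this
    simp [factorCount, h]
  | cons y s ih =>
    have h := prefix_append_cons_iff he (y :: s) d
    simp only [List.cons_append] at h
    simp only [List.cons_append, factorCount, ih, h]
    omega

/-! ### Reversing the maximal nonnegative runs of an integer list -/

/-- Reverse every maximal run of nonnegative entries; `acc` holds the reversal of the part of the
current run already read. -/
def reverseRuns : List ℤ → List ℤ → List ℤ
  | acc, [] => acc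
  | acc, e :: d => if e < 0 then acc ++ e :: reverseRuns [] d else reverseRuns (e :: acc) d

theorem runInduction {P : List ℤ → Prop} (run : ∀ s, (∀ x ∈ s, 0 ≤ x) → P s)
    (neg : ∀ s e d, (∀ x ∈ s, 0 ≤ x) → e < 0 → P d → P (s ++ e :: d)) (l : List ℤ) : P l := by
  suffices h : ∀ s, (∀ x ∈ s, 0 ≤ x) → P (s ++ l) from h [] (by simp)
  induction l with
  | nil => intro s hs; simpa using run s hs
  | cons e d ih =>
    intro s hs
    rcases lt_or_ge e 0 with he | he
    · exact neg s e d hs he (ih [] (by simp))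
    · have := ih (s ++ [e]) (by
        intro x hx
        rcases List.mem_append.1 hx with hx | hx
        · exact hs x hx
        · simp at hx; omega)
      simpa using this

theorem reverseRuns_append {s : List ℤ} (hs : ∀ x ∈ s, 0 ≤ x) (acc d : List ℤ) :
    reverseRuns acc (s ++ d) = reverseRuns (s.reverse ++ acc) d := by
  induction s generalizing acc with
  | nil => rfl
  | cons x s ih =>
    have hx : ¬ x < 0 := not_lt.2 (hs x (by simp))
    simp only [List.cons_append, reverseRuns, if_neg hx]
    rw [ih (fun y hy => hs y (by simp [hy]))]
    simp

theorem reverseRuns_of_nonneg {s : List ℤ} (hs : ∀ x ∈ s, 0 ≤ x) :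
    reverseRuns [] s = s.reverse := by
  have := reverseRuns_append hs [] []
  simpa [reverseRuns] using this

theorem reverseRuns_append_cons {s : List ℤ} (hs : ∀ x ∈ s, 0 ≤ x) {e : ℤ} (he : e < 0)
    (d : List ℤ) : reverseRuns [] (s ++ e :: d) = s.reverse ++ e :: reverseRuns [] d := by
  rw [reverseRuns_append hs]
  simp [reverseRuns, he]

theorem reverseRuns_involutive : Function.Involutive (reverseRuns []) := by
  intro l
  induction l using runInduction with
  | run s hs =>
    rw [reverseRuns_of_nonneg hs, reverseRuns_of_nonneg (by simpa using hs), List.reverse_reverse]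
  | neg s e d hs he ih =>
    rw [reverseRuns_append_cons hs he, reverseRuns_append_cons (by simpa using hs) he, ih,
      List.reverse_reverse]

theorem reverseRuns_perm (l : List ℤ) : (reverseRuns [] l).Perm l := by
  induction l using runInduction with
  | run s hs => rw [reverseRuns_of_nonneg hs]; exact List.reverse_perm s
  | neg s e d hs he ih =>
    rw [reverseRuns_append_cons hs he]
    exact (List.reverse_perm s).append (ih.cons e)

theorem factorCount_reverseRuns {u : List ℤ} (hu : u ≠ []) (hpos : ∀ x ∈ u, 0 ≤ x)
    (l : List ℤ) : factorCount u (reverseRuns [] l) = factorCount u.reverse l := by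
  induction l using runInduction with
  | run s hs => rw [reverseRuns_of_nonneg hs, factorCount_reverse hu]
  | neg s e d hs he ih =>
    have heu : e ∉ u := fun h => absurd (hpos e h) (not_le.2 he)
    rw [reverseRuns_append_cons hs he, factorCount_append_cons hu heu,
      factorCount_append_cons (by simpa using hu) (by simpa using heu), ih,
      factorCount_reverse hu]

theorem map_sign_reverseRuns (l : List ℤ) :
    (reverseRuns [] l).map Int.sign = reverseRuns [] (l.map Int.sign) := by
  induction l using runInduction with
  | run s hs =>
    rw [reverseRuns_of_nonneg hs, reverseRuns_of_nonneg, List.map_reverse]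
    intro x hx
    obtain ⟨y, hy, rfl⟩ := List.mem_map.1 hx
    exact Int.sign_nonneg_iff.2 (hs y hy)
  | neg s e d hs he ih =>
    rw [reverseRuns_append_cons hs he, List.map_append (l₁ := s), List.map_cons (l := d),
      reverseRuns_append_cons]
    · simp [ih]
    · intro x hx
      obtain ⟨y, hy, rfl⟩ := List.mem_map.1 hx
      exact Int.sign_nonneg_iff.2 (hs y hy)
    · exact Int.sign_neg_iff.2 he

/-- The steps, latest first, of a lattice path from height `0` that never goes below `0` and
never rises by more than `1` at a time. -/
def IsPath : List ℤ → Prop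
  | [] => True
  | e :: d => e ≤ 1 ∧ 0 ≤ e + d.sum ∧ IsPath d

theorem IsPath.sum_nonneg {d : List ℤ} (h : IsPath d) : 0 ≤ d.sum := by
  cases d with
  | nil => simp
  | cons e d => simpa using h.2.1

theorem isPath_append {s : List ℤ} (hs : ∀ x ∈ s, 0 ≤ x) (d : List ℤ) :
    IsPath (s ++ d) ↔ (∀ x ∈ s, x ≤ 1) ∧ IsPath d := by
  induction s with
  | nil => simp
  | cons x s ih =>
    have hx := hs x (by simp)
    have ih := ih (fun y hy => hs y (by simp [hy]))
    simp only [List.cons_append, IsPath, List.forall_mem_cons]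
    constructor
    · rintro ⟨h1, -, h3⟩
      exact ⟨⟨h1, (ih.1 h3).1⟩, (ih.1 h3).2⟩
    · rintro ⟨⟨h1, h2⟩, h3⟩
      have h := ih.2 ⟨h2, h3⟩
      exact ⟨h1, add_nonneg hx h.sum_nonneg, h⟩

theorem isPath_reverseRuns (l : List ℤ) : IsPath (reverseRuns [] l) ↔ IsPath l := by
  induction l using runInduction with
  | run s hs =>
    have h1 := isPath_append (s := s.reverse) (by simpa using hs) []
    have h2 := isPath_append hs []
    rw [reverseRuns_of_nonneg hs]
    simp only [List.append_nil, List.mem_reverse] at h1 h2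
    rw [h1, h2]
  | neg s e d hs he ih =>
    rw [reverseRuns_append_cons hs he, isPath_append (by simpa using hs), isPath_append hs]
    simp [IsPath, ih, (reverseRuns_perm d).sum_eq]

/-! ### Subword occurrences through signs of consecutive differences -/

/-- The signs of the consecutive differences of a word. -/
def signs (l : List ℕ) : List ℤ :=
  List.zipWith (fun x y : ℕ => Int.sign ((y : ℤ) - x)) l l.tail

theorem signs_cons_cons (x y : ℕ) (l : List ℕ) :
    signs (x :: y :: l) = Int.sign ((y : ℤ) - x) :: signs (y :: l) := rfl

theorem length_signs (l : List ℕ) : (signs l).length = l.length - 1 := by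
  simp [signs]

theorem getElem_signs (l : List ℕ) (i : ℕ) (h : i < (signs l).length) :
    (signs l)[i] = Int.sign ((l.getD (i + 1) 0 : ℤ) - l.getD i 0) := by
  have := length_signs l
  simp only [signs, List.getElem_zipWith, List.getElem_tail]
  rw [List.getD_eq_getElem _ _ (by omega), List.getD_eq_getElem _ _ (by omega)]

theorem signs_concat (l : List ℕ) (y x : ℕ) :
    signs (l ++ [y, x]) = signs (l ++ [y]) ++ [Int.sign ((x : ℤ) - y)] := by
  induction l with
  | nil => rfl
  | cons z l ih =>
    cases l with
    | nil => rfl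
    | cons w l =>
      simp only [List.cons_append, signs_cons_cons] at ih ⊢
      rw [ih]

theorem sign_sub_eq_iff {p q r s : ℕ} :
    Int.sign ((q : ℤ) - p) = Int.sign ((s : ℤ) - r) ↔
      (p < q ↔ r < s) ∧ (q < p ↔ s < r) := by
  rcases lt_trichotomy p q with h | h | h <;> rcases lt_trichotomy r s with h' | h' | h' <;>
    simp [h, h', Int.sign_eq_one_of_pos, Int.sign_eq_neg_one_of_neg, h.not_gt, h'.not_gt]

theorem ordIso_take_iff {τ l : List ℕ} (hτ : 2 ≤ τ.length)
    (hmono : ∀ j, j + 1 < τ.length → τ.getD j 0 ≤ τ.getD (j + 1) 0) :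
    OrdIso τ (l.take τ.length) ↔ signs τ <+: signs l := by
  have hget : ∀ j, j < τ.length → (l.take τ.length).getD j 0 = l.getD j 0 := by
    intro j hj
    simp [List.getD_eq_getElem?_getD, hj]
  have hpre : signs τ <+: signs l ↔ τ.length ≤ l.length ∧ ∀ j, j + 1 < τ.length →
      ((τ.getD j 0 < τ.getD (j + 1) 0 ↔ l.getD j 0 < l.getD (j + 1) 0) ∧
       (τ.getD (j + 1) 0 < τ.getD j 0 ↔ l.getD (j + 1) 0 < l.getD j 0)) := by
    have h1 := length_signs τ
    have h2 := length_signs l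
    rw [List.prefix_iff_getElem]
    constructor
    · rintro ⟨hl, h⟩
      refine ⟨by omega, fun j hj => ?_⟩
      have := h j (by omega)
      rw [getElem_signs, getElem_signs] at this
      exact sign_sub_eq_iff.1 this
    · rintro ⟨hl, h⟩
      refine ⟨by omega, fun j hj => ?_⟩
      rw [getElem_signs, getElem_signs]
      exact sign_sub_eq_iff.2 (h j (by omega))
  rw [hpre]
  constructor
  · rintro ⟨hl, h⟩
    simp only [List.length_take] at hl
    refine ⟨by omega, fun j hj => ?_⟩
    have e1 := h j (j + 1) (by omega) hj
    have e2 := h (j + 1) j hj (by omega)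
    rw [hget _ hj, hget _ (by omega)] at e1 e2
    exact ⟨e1, e2⟩
  · rintro ⟨hl, h⟩
    have key : ∀ j k, j ≤ k → k < τ.length → τ.getD j 0 ≤ τ.getD k 0 ∧
        l.getD j 0 ≤ l.getD k 0 ∧ (τ.getD j 0 < τ.getD k 0 ↔ l.getD j 0 < l.getD k 0) := by
      intro j k hjk
      induction k, hjk using Nat.le_induction with
      | base => simp
      | succ k hjk ih =>
        intro hk
        have h1 := ih (by omega)
        have h2 := h k hk
        have h3 := hmono k hk
        omega
    refine ⟨by simp [hl], fun j k hj hk => ?_⟩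
    rw [hget j hj, hget k hk]
    rcases le_total j k with hjk | hjk
    · exact (key j k hjk hk).2.2
    · have := key k j hjk hj
      omega

theorem occAt_lt_length {τ l : List ℕ} (hτ : τ ≠ []) {i : ℕ} (h : occAt τ l i) :
    i < l.length := by
  have h1 := h.1
  have := List.length_pos_iff.2 hτ
  simp at h1
  omega

open Classical in
theorem occCount_eq_sum {τ : List ℕ} (hτ : τ ≠ []) (l : List ℕ) :
    occCount τ l = ∑ i ∈ Finset.range l.length, if occAt τ l i then 1 else 0 := by
  rw [← Finset.card_filter, occCount]
  refine Nat.subtype_card _ fun i => ?_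
  simp only [Finset.mem_filter, Finset.mem_range, and_iff_right_iff_imp]
  exact occAt_lt_length hτ

theorem occCount_eq_factorCount {τ : List ℕ} (hτ : 2 ≤ τ.length)
    (hmono : ∀ j, j + 1 < τ.length → τ.getD j 0 ≤ τ.getD (j + 1) 0) (l : List ℕ) :
    occCount τ l = factorCount (signs τ) (signs l) := by
  classical
  have hne : τ ≠ [] := by rintro rfl; simp at hτ
  have hs : signs τ ≠ [] := by
    intro h
    have := length_signs τ
    rw [h] at this
    simp at this; omega
  induction l with
  | nil => simp [occCount_eq_sum hne, signs, factorCount]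
  | cons x l ih =>
    have h0 : occAt τ (x :: l) 0 ↔ signs τ <+: signs (x :: l) := ordIso_take_iff hτ hmono
    rw [occCount_eq_sum hne] at ih ⊢
    rw [List.length_cons, Finset.sum_range_succ']
    have hsucc : ∀ i, occAt τ (x :: l) (i + 1) ↔ occAt τ l i := fun i => Iff.rfl
    simp only [hsucc, ih, h0]
    cases l with
    | nil =>
      have hx : signs [x] = [] := rfl
      rw [hx, show signs [] = [] from rfl]
      simp [factorCount, hs]
    | cons y l => rw [signs_cons_cons, factorCount, add_comm]

/-! ### Non-crossing words read from right to left -/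

/-- The largest letter of a word (`0` for the empty word). -/
def maxLetter (w : List ℕ) : ℕ := w.foldr max 0

/-- The restricted growth condition on the reversal of a word. -/
def RevRGS : List ℕ → Prop
  | [] => True
  | x :: w => RevRGS w ∧ 1 ≤ x ∧ x ≤ maxLetter w + 1

/-- The crossing condition on the reversal of a word. -/
def RevCrossing (w : List ℕ) : Prop := ∃ a b, a < b ∧ [b, a, b, a].Sublist w

/-- The letters of the reversed word `w` followed by no smaller letter after their last
appearance. -/
def openLetters : List ℕ → Finset ℕ
  | [] => ∅
  | x :: w => insert x ((openLetters w).filter (· < x))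

/-- Words, latest letter first, built by appending either a new maximum or an open letter. -/
def RevNC : List ℕ → Prop
  | [] => True
  | x :: w => RevNC w ∧ (x = maxLetter w + 1 ∨ x ∈ openLetters w)

theorem le_maxLetter {w : List ℕ} {x : ℕ} (h : x ∈ w) : x ≤ maxLetter w := by
  induction w with
  | nil => simp at h
  | cons y w ih =>
    simp only [maxLetter, List.foldr_cons, List.mem_cons] at h ih ⊢
    rcases h with rfl | h
    · simp
    · exact (ih h).trans (le_max_right _ _)

theorem mem_of_mem_openLetters {w : List ℕ} {x : ℕ} (h : x ∈ openLetters w) : x ∈ w := by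
  induction w with
  | nil => simp [openLetters] at h
  | cons y w ih =>
    simp only [openLetters, Finset.mem_insert, Finset.mem_filter] at h
    rcases h with rfl | h
    · simp
    · exact List.mem_cons_of_mem _ (ih h.1)

theorem RevRGS.mem {w : List ℕ} (hw : RevRGS w) {x : ℕ} (h1 : 1 ≤ x)
    (h2 : x ≤ maxLetter w) : x ∈ w := by
  induction w with
  | nil => simp [maxLetter] at h2; omega
  | cons y w ih =>
    obtain ⟨hw, -, hy⟩ := hw
    rw [List.mem_cons]
    by_cases hx : x ≤ maxLetter w
    · exact Or.inr (ih hw hx)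
    · left
      simp only [maxLetter, List.foldr_cons] at h2 hx hy
      omega

theorem RevRGS.one_le {w : List ℕ} (hw : RevRGS w) {x : ℕ} (h : x ∈ w) : 1 ≤ x := by
  induction w with
  | nil => simp at h
  | cons y w ih =>
    rcases List.mem_cons.1 h with rfl | h
    · exact hw.2.1
    · exact ih hw.1 h

theorem RevRGS.pair_sublist {w : List ℕ} (hw : RevRGS w) {x z : ℕ} (hz : 1 ≤ z) (hzx : z < x)
    (hx : x ∈ w) : [x, z].Sublist w := by
  induction w with
  | nil => simp at hx
  | cons y w ih =>
    by_cases hxw : x ∈ w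
    · exact (ih hw.1 hxw).cons y
    · obtain rfl : x = y := by simpa [hxw] using hx
      rw [List.cons_sublist_cons, List.singleton_sublist]
      exact hw.1.mem hz (by have := hw.2.2; omega)

theorem mem_openLetters_iff {w : List ℕ} (hw : RevRGS w) (hc : ¬ RevCrossing w) (x : ℕ) :
    x ∈ openLetters w ↔ x ∈ w ∧ ∀ a < x, ¬ [a, x, a].Sublist w := by
  induction w with
  | nil => simp [openLetters]
  | cons z w ih =>
    have hc' : ¬ RevCrossing w := fun ⟨a, b, h, hs⟩ => hc ⟨a, b, h, hs.cons z⟩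
    have ih := ih hw.1 hc'
    simp only [openLetters, Finset.mem_insert, Finset.mem_filter]
    rcases lt_trichotomy x z with h | rfl | h
    · have hne : x ≠ z := h.ne
      simp only [hne, false_or, h, and_true, List.mem_cons, ih]
      refine and_congr_right fun _ => forall_congr' fun a => imp_congr_right fun ha => ?_
      have : a ≠ z := by omega
      rw [List.sublist_cons_iff]
      simp [this]
    · simp only [true_or, List.mem_cons, true_and, true_iff]
      intro a ha hs
      refine hc ⟨a, x, ha, ?_⟩
      rw [List.cons_sublist_cons]
      rcases List.sublist_cons_iff.1 hs with hs | ⟨r, hr, -⟩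
      · exact hs
      · simp at hr; omega
    · simp only [h.ne', false_or, h.not_gt, and_false, false_iff, List.mem_cons]
      rintro ⟨hx, hs⟩
      refine hs z h ?_
      rw [List.cons_sublist_cons]
      exact hw.1.pair_sublist hw.2.1 h hx

theorem revCrossing_cons {w : List ℕ} {x : ℕ} :
    RevCrossing (x :: w) ↔ RevCrossing w ∨ ∃ a < x, [a, x, a].Sublist w := by
  constructor
  · rintro ⟨a, b, h, hs⟩
    rcases List.sublist_cons_iff.1 hs with hs | ⟨r, hr, hs⟩
    · exact Or.inl ⟨a, b, h, hs⟩
    · simp only [List.cons.injEq] at hr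
      obtain ⟨rfl, rfl⟩ := hr
      exact Or.inr ⟨a, h, hs⟩
  · rintro (⟨a, b, h, hs⟩ | ⟨a, h, hs⟩)
    · exact ⟨a, b, h, hs.cons x⟩
    · exact ⟨a, x, h, hs.cons_cons x⟩

theorem revNC_iff (w : List ℕ) : RevNC w ↔ RevRGS w ∧ ¬ RevCrossing w := by
  induction w with
  | nil => simp [RevNC, RevRGS, RevCrossing]
  | cons x w ih =>
    rw [RevNC, ih, RevRGS, revCrossing_cons]
    constructor
    · rintro ⟨⟨hw, hc⟩, h⟩
      rcases h with rfl | h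
      · refine ⟨⟨hw, by omega, le_rfl⟩, ?_⟩
        rintro (h | ⟨a, -, hs⟩)
        · exact hc h
        · have := le_maxLetter (hs.subset (show maxLetter w + 1 ∈ _ by simp))
          omega
      · have hx := mem_of_mem_openLetters h
        have hmax := le_maxLetter hx
        refine ⟨⟨hw, hw.one_le hx, by omega⟩, ?_⟩
        rintro (h' | ⟨a, ha, hs⟩)
        · exact hc h'
        · exact ((mem_openLetters_iff hw hc x).1 h).2 a ha hs
    · rintro ⟨⟨hw, h1, h2⟩, h⟩
      rw [not_or] at h
      refine ⟨⟨hw, h.1⟩, ?_⟩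
      by_cases hx : x = maxLetter w + 1
      · exact Or.inl hx
      · right
        rw [mem_openLetters_iff hw h.1]
        exact ⟨hw.mem h1 (by omega), fun a ha hs => h.2 ⟨a, ha, hs⟩⟩

theorem isRGS_concat (l : List ℕ) (x : ℕ) :
    IsRGS (l ++ [x]) ↔ IsRGS l ∧ 1 ≤ x ∧ x ≤ l.foldr max 0 + 1 := by
  cases l with
  | nil =>
    simp [IsRGS]
    omega
  | cons y l =>
    have hget : ∀ i, i + 1 < (y :: l).length →
        ((y :: l) ++ [x]).getD (i + 1) 0 = (y :: l).getD (i + 1) 0 := fun i hi =>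
      List.getD_append _ _ _ _ hi
    have htake : ∀ i, i + 1 ≤ (y :: l).length →
        ((y :: l) ++ [x]).take (i + 1) = (y :: l).take (i + 1) := fun i hi =>
      List.take_append_of_le_length hi
    have hlast : ((y :: l) ++ [x]).getD (l.length + 1) 0 = x := by simp
    have hall : ((y :: l) ++ [x]).take (l.length + 1) = y :: l := by simp
    constructor
    · rintro ⟨h1, h2, h3⟩
      refine ⟨⟨h1, fun z hz => h2 z (List.mem_append_left _ hz), fun i hi => ?_⟩,
        h2 x (by simp), ?_⟩
      · have := h3 i (by simp at hi ⊢; omega)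
        rwa [hget i hi, htake i hi.le] at this
      · have := h3 l.length (by simp)
        rwa [hlast, hall] at this
    · rintro ⟨⟨h1, h2, h3⟩, h4, h5⟩
      refine ⟨h1, ?_, fun i hi => ?_⟩
      · intro z hz
        rcases List.mem_append.1 hz with hz | hz
        · exact h2 z hz
        · simp at hz; omega
      · rcases Nat.lt_or_ge (i + 1) (y :: l).length with h | h
        · rw [hget i h, htake i h.le]
          exact h3 i h
        · obtain rfl : i = l.length := by simp at hi h; omega
          rwa [hlast, hall]

theorem isRGS_reverse (w : List ℕ) : IsRGS w.reverse ↔ RevRGS w := by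
  induction w with
  | nil => simp [IsRGS, RevRGS]
  | cons x w ih =>
    have hmax : w.reverse.foldr max 0 = maxLetter w := (List.reverse_perm w).foldr_eq 0
    rw [List.reverse_cons, isRGS_concat, ih, hmax, RevRGS]

theorem crossing_reverse (w : List ℕ) : Crossing w.reverse ↔ RevCrossing w := by
  have hrev : RevCrossing w ↔ ∃ a b, a < b ∧ [a, b, a, b].Sublist w.reverse := by
    refine exists_congr fun a => exists_congr fun b => and_congr_right fun _ => ?_
    rw [← List.reverse_sublist]
    rfl
  rw [hrev]
  generalize w.reverse = l
  constructor
  · rintro ⟨i, j, k, m, hij, hjk, hkm, hm, h1, h2, h3⟩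
    refine ⟨l.getD i 0, l.getD j 0, h3, ?_⟩
    rw [List.sublist_iff_exists_fin_orderEmbedding_get_eq]
    refine ⟨OrderEmbedding.ofStrictMono
      (![⟨i, by omega⟩, ⟨j, by omega⟩, ⟨k, by omega⟩, ⟨m, hm⟩] : Fin 4 → Fin l.length) ?_, ?_⟩
    · rw [Fin.strictMono_iff_lt_succ]
      intro p
      fin_cases p <;> simp [hij, hjk, hkm]
    · rw [List.getD_eq_getElem _ _ (by omega), List.getD_eq_getElem _ _ (by omega)] at h1 h2
      intro p
      change Fin 4 at p
      fin_cases p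
      · simp [List.getElem?_eq_getElem (show i < l.length by omega)]
      · simp [List.getElem?_eq_getElem (show j < l.length by omega)]
      · simp [List.getElem?_eq_getElem (show i < l.length by omega), h1]
      · simp [List.getElem?_eq_getElem (show j < l.length by omega), h2]
  · rintro ⟨a, b, hab, hs⟩
    obtain ⟨f, hf⟩ := List.sublist_iff_exists_fin_orderEmbedding_get_eq.1 hs
    have hval : ∀ p, l.getD (f p) 0 = [a, b, a, b].get p := fun p => by
      rw [hf, List.getD_eq_getElem _ _ (f p).2]
      rfl
    have hlt : ∀ p q : Fin 4, p < q → (f p : ℕ) < f q := fun p q h => f.lt_iff_lt.2 h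
    refine ⟨f 0, f 1, f 2, f 3, hlt 0 1 (by decide), hlt 1 2 (by decide), hlt 2 3 (by decide),
      (f 3).2, ?_, ?_, ?_⟩
    · rw [hval, hval]; rfl
    · rw [hval, hval]; rfl
    · rw [hval, hval]; exact hab

theorem ncseq_iff {n : ℕ} {l : List ℕ} : NCseq n l ↔ l.length = n ∧ RevNC l.reverse := by
  rw [NCseq, revNC_iff, ← isRGS_reverse, ← crossing_reverse, List.reverse_reverse]

/-! ### The lattice path of a non-crossing word -/

/-- The successive changes, latest first, of the number of open letters. -/
def steps : List ℕ → List ℤ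
  | [] => []
  | [_] => []
  | x :: y :: w =>
    ((openLetters (x :: y :: w)).card - (openLetters (y :: w)).card : ℤ) :: steps (y :: w)

theorem length_steps (w : List ℕ) : (steps w).length = w.length - 1 := by
  fun_induction steps w <;> simp_all

theorem card_openLetters_cons (x : ℕ) (w : List ℕ) :
    (openLetters (x :: w)).card = ((openLetters w).filter (· < x)).card + 1 := by
  rw [openLetters, Finset.card_insert_of_notMem (by simp)]

theorem sum_steps (x : ℕ) (w : List ℕ) :
    (steps (x :: w)).sum = (openLetters (x :: w)).card - 1 := by
  induction w generalizing x with
  | nil => simp [steps, openLetters]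
  | cons y w ih =>
    rw [steps, List.sum_cons, ih]
    ring

theorem isPath_steps (w : List ℕ) : IsPath (steps w) := by
  fun_induction steps w with
  | case1 => trivial
  | case2 => trivial
  | case3 x y w ih =>
    refine ⟨?_, ?_, ih⟩
    · have := Finset.card_filter_le (openLetters (y :: w)) (· < x)
      rw [card_openLetters_cons x]
      omega
    · rw [sum_steps, card_openLetters_cons x]
      omega

theorem le_head_of_mem_openLetters {x y : ℕ} {w : List ℕ} (h : x ∈ openLetters (y :: w)) :
    x ≤ y := by
  simp only [openLetters, Finset.mem_insert, Finset.mem_filter] at h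
  omega

theorem head_mem_openLetters (y : ℕ) (w : List ℕ) : y ∈ openLetters (y :: w) := by
  simp [openLetters]

theorem filter_openLetters_of_new {w : List ℕ} :
    (openLetters w).filter (· < maxLetter w + 1) = openLetters w :=
  Finset.filter_true_of_mem fun _ hz =>
    Nat.lt_succ_of_le (le_maxLetter (mem_of_mem_openLetters hz))

theorem sign_step {x y : ℕ} {w : List ℕ} (h : RevNC (x :: y :: w)) :
    Int.sign ((openLetters (x :: y :: w)).card - (openLetters (y :: w)).card : ℤ) =
      Int.sign ((x : ℤ) - y) := by
  rw [card_openLetters_cons x]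
  rcases h.2 with rfl | hx
  · have hy := le_maxLetter (List.mem_cons_self (a := y) (l := w))
    rw [filter_openLetters_of_new, Int.sign_eq_one_of_pos (by omega),
      Int.sign_eq_one_of_pos (by omega)]
  · rcases (le_head_of_mem_openLetters hx).lt_or_eq with hxy | rfl
    · have hsub : insert y (insert x ((openLetters (y :: w)).filter (· < x))) ⊆
          openLetters (y :: w) := by
        intro z hz
        simp only [Finset.mem_insert, Finset.mem_filter] at hz
        rcases hz with rfl | rfl | hz
        · exact head_mem_openLetters _ _
        · exact hx
        · exact hz.1
      have := Finset.card_le_card hsub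
      rw [Finset.card_insert_of_notMem (by simp; omega),
        Finset.card_insert_of_notMem (by simp)] at this
      rw [Int.sign_eq_neg_one_of_neg (by omega), Int.sign_eq_neg_one_of_neg (by omega)]
    · have : (openLetters (x :: w)).filter (· < x) = (openLetters w).filter (· < x) := by
        ext z
        simp only [openLetters, Finset.mem_filter, Finset.mem_insert]
        constructor
        · rintro ⟨rfl | hz, hzx⟩
          · exact absurd hzx (lt_irrefl _)
          · exact hz
        · exact fun hz => ⟨Or.inr hz, hz.2⟩
      rw [this, card_openLetters_cons]
      simp

theorem signs_reverse {w : List ℕ} (h : RevNC w) :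
    signs w.reverse = ((steps w).map Int.sign).reverse := by
  fun_induction steps w with
  | case1 => rfl
  | case2 => rfl
  | case3 x y w ih =>
    have ih := ih h.1
    simp only [List.reverse_cons, List.append_assoc, List.cons_append, List.nil_append,
      List.map_cons] at ih ⊢
    rw [signs_concat, ih, sign_step h]

theorem RevNC.head_le_of_card_le {x x' : ℕ} {w : List ℕ} (h : RevNC (x :: w))
    (h' : RevNC (x' :: w))
    (hc : (openLetters (x :: w)).card ≤ (openLetters (x' :: w)).card) : x ≤ x' := by
  by_contra! hlt
  rw [card_openLetters_cons, card_openLetters_cons] at hc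
  have hx' : x' ∈ openLetters w := by
    rcases h'.2 with rfl | h'
    · rcases h.2 with rfl | h
      · omega
      · have := le_maxLetter (mem_of_mem_openLetters h)
        omega
    · exact h'
  have : (openLetters w).filter (· < x') ⊂ (openLetters w).filter (· < x) := by
    refine Finset.ssubset_iff_of_subset ?_ |>.2 ⟨x', by simp [hx', hlt], by simp⟩
    exact Finset.monotone_filter_right _ fun z _ hz => hz.trans hlt
  have := Finset.card_lt_card this
  omega

theorem steps_injOn {w w' : List ℕ} (h : RevNC w) (h' : RevNC w')
    (hl : w.length = w'.length) (hs : steps w = steps w') : w = w' := by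
  induction w generalizing w' with
  | nil => simpa [eq_comm] using hl
  | cons x w ih =>
    obtain _ | ⟨x', w'⟩ := w'
    · simp at hl
    have hl' : w.length = w'.length := by simpa using hl
    have hsum : (openLetters (x :: w)).card = (openLetters (x' :: w')).card := by
      have h1 := sum_steps x w
      have h2 := sum_steps x' w'
      rw [hs] at h1
      omega
    have htail : steps w = steps w' := by
      cases w with
      | nil =>
        obtain rfl : w' = [] := by simpa [eq_comm] using hl'
        rfl
      | cons y w =>
        obtain _ | ⟨y', w'⟩ := w'
        · simp at hl'
        · simp only [steps, List.cons.injEq] at hs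
          exact hs.2
    obtain rfl := ih h.1 h'.1 hl' htail
    rw [le_antisymm (h.head_le_of_card_le h' hsum.le) (h'.head_le_of_card_le h hsum.ge)]

theorem exists_card_filter_lt_eq (S : Finset ℕ) {k : ℕ} (hk : k < S.card) :
    ∃ x ∈ S, (S.filter (· < x)).card = k := by
  induction S using Finset.induction_on_max with
  | empty => simp at hk
  | insert a S ha ih =>
    have haS : a ∉ S := fun h => lt_irrefl _ (ha a h)
    rw [Finset.card_insert_of_notMem haS] at hk
    rcases Nat.lt_succ_iff_lt_or_eq.1 hk with hk | rfl
    · obtain ⟨x, hx, hc⟩ := ih hk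
      refine ⟨x, Finset.mem_insert_of_mem hx, ?_⟩
      rw [Finset.filter_insert, if_neg (ha x hx).not_gt, hc]
    · refine ⟨a, Finset.mem_insert_self _ _, ?_⟩
      rw [Finset.filter_insert, if_neg (lt_irrefl a), Finset.filter_true_of_mem ha]

theorem exists_revNC_cons {w : List ℕ} (hw : RevNC w) {h : ℕ} (h1 : 1 ≤ h)
    (h2 : h ≤ (openLetters w).card + 1) :
    ∃ x, RevNC (x :: w) ∧ (openLetters (x :: w)).card = h := by
  by_cases hh : h = (openLetters w).card + 1
  · refine ⟨maxLetter w + 1, ⟨hw, Or.inl rfl⟩, ?_⟩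
    rw [card_openLetters_cons, filter_openLetters_of_new, hh]
  · obtain ⟨x, hx, hc⟩ := exists_card_filter_lt_eq (openLetters w) (k := h - 1) (by omega)
    refine ⟨x, ⟨hw, Or.inr hx⟩, ?_⟩
    rw [card_openLetters_cons, hc]
    omega

theorem exists_steps_eq {d : List ℤ} (hd : IsPath d) :
    ∃ w, RevNC w ∧ w.length = d.length + 1 ∧ steps w = d := by
  induction d with
  | nil => exact ⟨[1], ⟨trivial, Or.inl rfl⟩, rfl, rfl⟩
  | cons e d ih =>
    obtain ⟨he, hsum, hd⟩ := hd
    obtain ⟨_ | ⟨y, w⟩, hw, hlen, rfl⟩ := ih hd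
    · simp at hlen
    rw [sum_steps] at hsum
    obtain ⟨x, hx, hc⟩ := exists_revNC_cons hw
      (h := (e + (openLetters (y :: w)).card).toNat) (by omega) (by omega)
    refine ⟨x :: y :: w, hx, by simpa using hlen, ?_⟩
    rw [steps, hc]
    congr 1
    omega

/-! ### Equidistribution -/

theorem card_ncseq_occCount {τ : List ℕ} (hτ : 2 ≤ τ.length)
    (hmono : ∀ j, j + 1 < τ.length → τ.getD j 0 ≤ τ.getD (j + 1) 0) (n k : ℕ) :
    Nat.card {l : List ℕ // NCseq (n + 1) l ∧ occCount τ l = k} =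
      Nat.card {d : List ℤ // d.length = n ∧ IsPath d ∧
        factorCount (signs τ).reverse (d.map Int.sign) = k} := by
  have hne : signs τ ≠ [] := by
    rw [← List.length_pos_iff, length_signs]
    omega
  have hocc : ∀ l, NCseq (n + 1) l →
      occCount τ l = factorCount (signs τ).reverse ((steps l.reverse).map Int.sign) := by
    intro l hl
    rw [occCount_eq_factorCount hτ hmono, ← factorCount_reverse hne,
      ← signs_reverse (ncseq_iff.1 hl).2, List.reverse_reverse]
  refine Nat.card_congr (Equiv.ofBijective (fun l => ⟨steps l.1.reverse, ?_, isPath_steps _, ?_⟩)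
    ⟨?_, ?_⟩)
  · simp [length_steps, l.2.1.1]
  · rw [← hocc _ l.2.1, l.2.2]
  · rintro ⟨l, hl, _⟩ ⟨l', hl', _⟩ h
    have := steps_injOn (ncseq_iff.1 hl).2 (ncseq_iff.1 hl').2 (by simp [hl.1, hl'.1])
      (congrArg Subtype.val h)
    exact Subtype.ext (List.reverse_injective this)
  · rintro ⟨d, hlen, hd, hc⟩
    obtain ⟨w, hw, hwl, rfl⟩ := exists_steps_eq hd
    have hnc : NCseq (n + 1) w.reverse := ncseq_iff.2 ⟨by simp [hwl, hlen], by simpa using hw⟩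
    exact ⟨⟨w.reverse, hnc, by rw [hocc _ hnc, List.reverse_reverse, hc]⟩, by simp⟩

theorem card_path_factorCount_reverse {u : List ℤ} (hu : u ≠ []) (hpos : ∀ x ∈ u, 0 ≤ x)
    (n k : ℕ) :
    Nat.card {d : List ℤ // d.length = n ∧ IsPath d ∧
        factorCount u.reverse (d.map Int.sign) = k} =
      Nat.card {d : List ℤ // d.length = n ∧ IsPath d ∧ factorCount u (d.map Int.sign) = k} := by
  refine Nat.card_congr (reverseRuns_involutive.toPerm.subtypeEquiv fun d => ?_)
  rw [Function.Involutive.coe_toPerm, (reverseRuns_perm d).length_eq, isPath_reverseRuns,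
    map_sign_reverseRuns, factorCount_reverseRuns hu hpos]

theorem getD_levels_ascents (a m i : ℕ) (hi : i < a + (m - 1)) :
    (List.replicate a 1 ++ (List.range (m - 1)).map (· + 2)).getD i 0 =
      if i < a then 1 else i - a + 2 := by
  split_ifs with h
  · rw [List.getD_append _ _ _ _ (by simpa using h)]
    simp [h]
  · rw [List.getD_append_right _ _ _ _ (by simpa using h)]
    rw [List.getD_eq_getElem _ _ (by simp; omega)]
    simp

theorem getD_ascents_levels (a m i : ℕ) (hi : i < (m - 1) + a) :
    ((List.range (m - 1)).map (· + 1) ++ List.replicate a m).getD i 0 =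
      if i < m - 1 then i + 1 else m := by
  split_ifs with h
  · rw [List.getD_append _ _ _ _ (by simpa using h)]
    rw [List.getD_eq_getElem _ _ (by simpa using h)]
    simp
  · rw [List.getD_append_right _ _ _ _ (by simpa using h)]
    rw [List.getD_eq_getElem _ _ (by simp; omega)]
    simp

theorem signs_levels_ascents {a m : ℕ} (ha : 1 ≤ a) :
    signs (List.replicate a 1 ++ (List.range (m - 1)).map (· + 2)) =
      List.replicate (a - 1) 0 ++ List.replicate (m - 1) 1 := by
  have hlen := length_signs (List.replicate a 1 ++ (List.range (m - 1)).map (· + 2))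
  simp only [List.length_append, List.length_replicate, List.length_map, List.length_range] at hlen
  refine List.ext_getElem (by simp; omega) fun i h1 h2 => ?_
  rw [getElem_signs, getD_levels_ascents _ _ _ (by omega), getD_levels_ascents _ _ _ (by omega),
    List.getElem_append]
  simp only [List.length_replicate, List.getElem_replicate]
  split_ifs <;> first | omega | (apply Int.sign_eq_one_of_pos; omega) | simp

theorem signs_ascents_levels {a m : ℕ} (ha : 1 ≤ a) (hm : 1 ≤ m) :
    signs ((List.range (m - 1)).map (· + 1) ++ List.replicate a m) =
      List.replicate (m - 1) 1 ++ List.replicate (a - 1) 0 := by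
  have hlen := length_signs ((List.range (m - 1)).map (· + 1) ++ List.replicate a m)
  simp only [List.length_append, List.length_replicate, List.length_map, List.length_range] at hlen
  refine List.ext_getElem (by simp; omega) fun i h1 h2 => ?_
  rw [getElem_signs, getD_ascents_levels _ _ _ (by omega), getD_ascents_levels _ _ _ (by omega),
    List.getElem_append]
  simp only [List.length_replicate, List.getElem_replicate]
  split_ifs <;> first | omega | (apply Int.sign_eq_one_of_pos; omega) | simp

/-- For a, m ≥ 2, the subwords 1^a 23⋯m and 12⋯(m−1)m^a are equidistributed
on NC_n. -/
theorem stmt17 (a m n k : ℕ) (ha : 2 ≤ a) (hm : 2 ≤ m) :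
    Nat.card {l : List ℕ // NCseq n l ∧
        occCount (List.replicate a 1 ++ (List.range (m - 1)).map (· + 2)) l = k} =
      Nat.card {l : List ℕ // NCseq n l ∧
        occCount ((List.range (m - 1)).map (· + 1) ++ List.replicate a m) l = k} := by
  set τ := List.replicate a 1 ++ (List.range (m - 1)).map (· + 2) with hτ
  set σ := (List.range (m - 1)).map (· + 1) ++ List.replicate a m with hσ
  have lτ : τ.length = a + (m - 1) := by simp [hτ]
  have lσ : σ.length = (m - 1) + a := by simp [hσ]
  have mτ : ∀ j, j + 1 < τ.length → τ.getD j 0 ≤ τ.getD (j + 1) 0 := by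
    intro j hj
    rw [hτ, getD_levels_ascents _ _ _ (by omega), getD_levels_ascents _ _ _ (by omega)]
    split_ifs <;> omega
  have mσ : ∀ j, j + 1 < σ.length → σ.getD j 0 ≤ σ.getD (j + 1) 0 := by
    intro j hj
    rw [hσ, getD_ascents_levels _ _ _ (by omega), getD_ascents_levels _ _ _ (by omega)]
    split_ifs <;> omega
  cases n with
  | zero =>
    have hnil : ∀ ρ : List ℕ, ρ ≠ [] → ∀ l, NCseq 0 l → occCount ρ l = 0 := by
      intro ρ hρ l hl
      simp [occCount_eq_sum hρ, hl.1]
    have hne : τ ≠ [] ∧ σ ≠ [] := by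
      simp only [← List.length_pos_iff]
      omega
    refine Nat.card_congr (Equiv.subtypeEquivRight fun l => and_congr_right fun hl => ?_)
    rw [hnil τ hne.1 l hl, hnil σ hne.2 l hl]
  | succ n =>
    have sτ : signs τ = List.replicate (a - 1) 0 ++ List.replicate (m - 1) 1 :=
      signs_levels_ascents (by omega)
    have sσ : signs σ = (signs τ).reverse := by
      rw [sτ, hσ, signs_ascents_levels (by omega) (by omega)]
      simp
    have hne : signs τ ≠ [] := by
      rw [← List.length_pos_iff, length_signs]
      omega
    have hpos : ∀ x ∈ signs τ, 0 ≤ x := by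
      intro x hx
      rw [sτ, List.mem_append, List.mem_replicate, List.mem_replicate] at hx
      omega
    rw [card_ncseq_occCount (by omega) mτ, card_ncseq_occCount (by omega) mσ, sσ,
      List.reverse_reverse, card_path_factorCount_reverse hne hpos]
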